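/- arXiv:2407.17712 — 3 statements merged into one kernel-verified Lean document; each statement's English description precedes it below -/
import Mathlib

section
/- Let b ≥ 2 be an integer, λ ∈ (1/b, 1) a real number, and set k = ⌊λb⌋. Let x ≥ k and y ≥ b be integers. Then k / (1 − (1 − 1/b)^k) ≤ (λ/(1 − e^{−λ})) · (min(b, x) + |y − x|). -/
/-- The function `t ↦ t / (1 - exp (-t))` is monotone on the positive reals. -/
theorem div_one_sub_exp_neg_le {s t : ℝ} (hs : 0 < s) (hst : s ≤ t) :
    s / (1 - Real.exp (-s)) ≤ t / (1 - Real.exp (-t)) := by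
  have ht : 0 < t := hs.trans_le hst
  have hes : Real.exp (-s) < 1 := Real.exp_lt_one_iff.2 (by linarith)
  have het : Real.exp (-t) < 1 := Real.exp_lt_one_iff.2 (by linarith)
  have hconv := convexOn_exp.2 (Set.mem_univ (-t)) (Set.mem_univ 0)
    (div_nonneg hs.le ht.le) (sub_nonneg.2 ((div_le_one ht).2 hst)) (by ring)
  have harg : (s / t) • (-t) + (1 - s / t) • (0 : ℝ) = -s := by
    simp only [smul_eq_mul]
    field_simp
    ring
  rw [harg, Real.exp_zero] at hconv
  simp only [smul_eq_mul] at hconv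
  rw [div_le_div_iff₀ (by linarith) (by linarith)]
  have hmul := mul_le_mul_of_nonneg_left hconv ht.le
  have hexpand : t * (s / t * Real.exp (-t) + (1 - s / t) * 1) =
      s * Real.exp (-t) + (t - s) := by
    field_simp
  linarith

theorem le_min_add_abs_sub {b x y : ℕ} (hy : b ≤ y) :
    (b : ℝ) ≤ (min b x : ℕ) + |(y : ℝ) - x| := by
  have hy' : (b : ℝ) ≤ y := by exact_mod_cast hy
  rcases le_total b x with h | h
  · rw [min_eq_left h]
    linarith [abs_nonneg ((y : ℝ) - x)]
  · rw [min_eq_right h]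
    linarith [le_abs_self ((y : ℝ) - x)]

theorem one_sub_inv_pow_le_exp {b : ℕ} (hb : 1 ≤ b) (k : ℕ) :
    (1 - 1 / (b : ℝ)) ^ k ≤ Real.exp (-(k / b)) := by
  have hb' : (1 : ℝ) ≤ b := by exact_mod_cast hb
  have hnonneg : 0 ≤ 1 - 1 / (b : ℝ) :=
    sub_nonneg.2 ((div_le_one (by linarith)).2 hb')
  calc (1 - 1 / (b : ℝ)) ^ k ≤ Real.exp (-(1 / b)) ^ k :=
        pow_le_pow_left₀ hnonneg (Real.one_sub_le_exp_neg _) k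
    _ = Real.exp (-(k / b)) := by
        rw [← Real.exp_nat_mul]
        ring_nf

theorem ski_randomized_case_i (b : ℕ) (hb : 2 ≤ b) (l : ℝ)
    (hl : 1 / (b : ℝ) < l) (hl1 : l < 1) (x y : ℕ)
    (hx : ⌊l * b⌋₊ ≤ x) (hy : b ≤ y) :
    (⌊l * b⌋₊ : ℝ) / (1 - (1 - 1 / (b : ℝ)) ^ (⌊l * b⌋₊)) ≤
      (l / (1 - Real.exp (-l))) * ((min b x : ℕ) + |(y : ℝ) - x|) := by
  have hb0 : (0 : ℝ) < b := by exact_mod_cast (by omega : 0 < b)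
  have hl0 : 0 < l := lt_trans (by positivity) hl
  have hk : 0 < ⌊l * b⌋₊ := Nat.floor_pos.2 ((div_lt_iff₀ hb0).1 hl).le
  have hkl : (⌊l * b⌋₊ : ℝ) / b ≤ l :=
    (div_le_iff₀ hb0).2 (Nat.floor_le (by positivity))
  generalize ⌊l * b⌋₊ = k at *
  have hkb : 0 < (k : ℝ) / b := div_pos (by exact_mod_cast hk) hb0
  have hexp : Real.exp (-(k / b : ℝ)) < 1 := Real.exp_lt_one_iff.2 (by linarith)
  have hexpl : Real.exp (-l) < 1 := Real.exp_lt_one_iff.2 (by linarith)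
  calc (k : ℝ) / (1 - (1 - 1 / (b : ℝ)) ^ k)
      ≤ k / (1 - Real.exp (-(k / b))) :=
        div_le_div_of_nonneg_left (Nat.cast_nonneg k) (by linarith)
          (by linarith [one_sub_inv_pow_le_exp (by omega : 1 ≤ b) k])
    _ = (k / b) / (1 - Real.exp (-(k / b))) * b := by
        rw [div_mul_eq_mul_div, div_mul_cancel₀ _ hb0.ne']
    _ ≤ l / (1 - Real.exp (-l)) * b :=
        mul_le_mul_of_nonneg_right (div_one_sub_exp_neg_le hkb hkl) hb0.le
    _ ≤ _ := mul_le_mul_of_nonneg_left (le_min_add_abs_sub hy)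
        (div_nonneg hl0.le (by linarith))
end

section
/- Let b ≥ 2 be an integer and λ ∈ (1/b, 1) a real number. Then (1/λ + 1/b)/(1 − e^{−1/λ}) ≤ (1 + 1/b)/(1 − e^{−(λ − 1/b)}). -/
/-- The function `(exp t - 1) / t - t` is antitone on `(0, 1]`. -/
lemma antitoneOn_exp_sub_one_div_sub :
    AntitoneOn (fun t : ℝ => (Real.exp t - 1) / t - t) (Set.Ioc 0 1) := by
  have hderiv : ∀ t : ℝ, 0 < t → HasDerivAt (fun t : ℝ => (Real.exp t - 1) / t - t)
      ((Real.exp t * t - (Real.exp t - 1) * 1) / t ^ 2 - 1) t := fun t ht =>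
    (((Real.hasDerivAt_exp t).sub_const 1).div (hasDerivAt_id t) ht.ne').sub (hasDerivAt_id t)
  refine antitoneOn_of_deriv_nonpos (convex_Ioc 0 1)
    (fun t ht => (hderiv t ht.1).continuousAt.continuousWithinAt) ?_ ?_
  all_goals
    intro t ht
    rw [interior_Ioc] at ht
  · exact (hderiv t ht.1).differentiableAt.differentiableWithinAt
  · rw [(hderiv t ht.1).deriv, sub_nonpos, div_le_one (pow_pos ht.1 2)]
    nlinarith [Real.add_one_le_exp t, ht.1, ht.2]

/-- A quadratic lower bound for `exp` on `(0, 1]`, with equality at `0` and `1`. -/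
lemma quadratic_le_exp {t : ℝ} (ht0 : 0 < t) (ht1 : t ≤ 1) :
    1 + (Real.exp 1 - 2) * t + t ^ 2 ≤ Real.exp t := by
  have h := antitoneOn_exp_sub_one_div_sub ⟨ht0, ht1⟩ ⟨one_pos, le_rfl⟩ ht1
  simp only [div_one] at h
  have h' : Real.exp 1 - 2 + t ≤ (Real.exp t - 1) / t := by linarith
  rw [le_div_iff₀ ht0] at h'
  linarith

lemma one_sub_exp_neg_le {l : ℝ} (hl0 : 0 < l) (hl1 : l < 1) :
    1 - Real.exp (-l) ≤ l * (1 - Real.exp (-(1 / l))) := by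
  have hquad := quadratic_le_exp (t := 1 - l) (by linarith) (by linarith)
  have hpos := Real.exp_pos (-1)
  have hinv : Real.exp (-1) * Real.exp 1 = 1 := by simp [← Real.exp_add]
  have hsplit : Real.exp (-l) = Real.exp (-1) * Real.exp (1 - l) := by
    rw [← Real.exp_add]; ring_nf
  have hlower : l ^ 2 * Real.exp (-1) ≤ Real.exp (-l) - 1 + l := by
    rw [hsplit]
    linear_combination Real.exp (-1) * hquad + (l - 1) * hinv
  have hupper : Real.exp (-(1 / l)) ≤ l * Real.exp (-1) := by
    have h1 : 1 / l ≤ Real.exp (1 / l - 1) := by linarith [Real.add_one_le_exp (1 / l - 1)]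
    have h2 : Real.exp (-1) = Real.exp (-(1 / l)) * Real.exp (1 / l - 1) := by
      rw [← Real.exp_add]; ring_nf
    rw [div_le_iff₀ hl0] at h1
    rw [h2]
    nlinarith [Real.exp_pos (-(1 / l))]
  nlinarith

theorem robustness_scalar_ineq (b : ℕ) (hb : 2 ≤ b) (l : ℝ)
    (hl : 1 / (b : ℝ) < l) (hl1 : l < 1) :
    (1 / l + 1 / (b : ℝ)) / (1 - Real.exp (-(1 / l))) ≤
      (1 + 1 / (b : ℝ)) / (1 - Real.exp (-(l - 1 / (b : ℝ)))) := by
  have hε : 0 < 1 / (b : ℝ) := by positivity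
  generalize 1 / (b : ℝ) = ε at *
  have hl0 : 0 < l := hε.trans hl
  have hinv : 1 < 1 / l := by rwa [lt_div_iff₀ hl0, one_mul]
  have hbase : 1 / l * (1 - Real.exp (-l)) ≤ 1 - Real.exp (-(1 / l)) := by
    rw [one_div_mul_eq_div, div_le_iff₀' hl0]
    exact one_sub_exp_neg_le hl0 hl1
  have hexp_l : Real.exp (-l) ≤ Real.exp (-(l - ε)) := Real.exp_le_exp.2 (by linarith)
  have hexp_inv : Real.exp (-(1 / l)) ≤ Real.exp (-(l - ε)) := Real.exp_le_exp.2 (by linarith)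
  have hden_left : Real.exp (-(1 / l)) < 1 := Real.exp_lt_one_iff.2 (by linarith)
  have hden_right : Real.exp (-(l - ε)) < 1 := Real.exp_lt_one_iff.2 (by linarith)
  rw [div_le_div_iff₀ (by linarith) (by linarith)]
  have h1 := mul_le_mul_of_nonneg_left hexp_l (zero_le_one.trans hinv.le)
  have h2 := mul_le_mul_of_nonneg_left hexp_inv hε.le
  linarith
end

section
/- Let n ≥ 1 and let x_1 ≤ x_2 ≤ ... ≤ x_n be nonnegative real numbers, and let y_1, ..., y_n be real numbers. Let η = Σ_{j=1}^n |x_j − y_j|, OPT = Σ_{j=1}^n (n − j + 1)·x_j, and ALG = Σ_{j=1}^n x_j + Σ_{i<j, y_i<y_j} x_i + Σ_{i<j, y_i≥y_j} x_j. Then ALG ≤ OPT + (n − 1)·η. -/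
/-- Summing `f i` over all pairs `i < j` counts each `f i` once for every later index. -/
lemma Fin.sum_sum_ite_lt_left {n : ℕ} (f : Fin n → ℝ) :
    ∑ j, ∑ i, (if i < j then f i else 0) = ∑ i : Fin n, ((n : ℝ) - 1 - i) * f i := by
  rw [Finset.sum_comm]
  refine Finset.sum_congr rfl fun i _ => ?_
  have hcard : ((n - 1 - (i : ℕ) : ℕ) : ℝ) = (n : ℝ) - 1 - i := by
    have hi := i.isLt
    rw [Nat.cast_sub (by omega), Nat.cast_sub (by omega), Nat.cast_one]
  rw [← Finset.sum_filter, Finset.filter_lt_eq_Ioi, Finset.sum_const, Fin.card_Ioi,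
    nsmul_eq_mul, hcard]

/-- Summing `f j` over all pairs `i < j` counts each `f j` once for every earlier index. -/
lemma Fin.sum_sum_ite_lt_right {n : ℕ} (f : Fin n → ℝ) :
    ∑ j, ∑ i, (if i < j then f j else 0) = ∑ j : Fin n, (j : ℝ) * f j := by
  refine Finset.sum_congr rfl fun j _ => ?_
  rw [← Finset.sum_filter, Finset.filter_gt_eq_Iio, Finset.sum_const, Fin.card_Iio,
    nsmul_eq_mul]

/-- The delay caused by a pair of jobs exceeds the first of them by at most their total error. -/
lemma ite_lt_le_add_abs_sub_add_abs_sub (a b c d : ℝ) :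
    (if c < d then a else b) ≤ a + (|a - c| + |b - d|) := by
  have ha := neg_abs_le (a - c)
  have hb := le_abs_self (b - d)
  split_ifs with h
  · linarith [abs_nonneg (a - c), abs_nonneg (b - d)]
  · linarith

theorem spjf_additive (n : ℕ) (hn : 1 ≤ n) (x y : Fin n → ℝ)
    (hmono : Monotone x) (hx0 : ∀ j, 0 ≤ x j) :
    ((∑ j, x j) +
        ∑ j, ∑ i, (if i < j then (if y i < y j then x i else x j) else 0)) ≤
      (∑ j, ((n : ℝ) - j) * x j) + ((n : ℝ) - 1) * (∑ j, |x j - y j|) := by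
  have hpair : ∑ j, ∑ i, (if i < j then (if y i < y j then x i else x j) else 0) ≤
      ∑ j, ∑ i, ((if i < j then x i + |x i - y i| else 0) +
        (if i < j then |x j - y j| else 0)) := by
    refine Finset.sum_le_sum fun j _ => Finset.sum_le_sum fun i _ => ?_
    by_cases hij : i < j
    · simpa only [if_pos hij, add_assoc] using
        ite_lt_le_add_abs_sub_add_abs_sub (x i) (x j) (y i) (y j)
    · simp [hij]
  simp only [Finset.sum_add_distrib] at hpair
  rw [Fin.sum_sum_ite_lt_left fun i => x i + |x i - y i|,
    Fin.sum_sum_ite_lt_right fun j => |x j - y j|] at hpair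
  refine (add_le_add_right hpair _).trans_eq ?_
  rw [Finset.mul_sum]
  simp only [← Finset.sum_add_distrib]
  exact Finset.sum_congr rfl fun j _ => by ring
end
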